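/- arXiv:2505.11567 — 2 statements merged into one kernel-verified Lean document; each statement's English description precedes it below -/
import Mathlib

section
/- Let n ≥ 1 and let S ∈ ℂ^{n×n} be a Hermitian positive definite matrix that is not diagonal (i.e., it has a nonzero off-diagonal entry). Then there exists a unitary matrix U ∈ ℂ^{n×n} such that the product of the diagonal entries of U S U* is strictly smaller than the product of the diagonal entries of S: ∏_{i=1}^{n} (U S U*)_{ii} < ∏_{i=1}^{n} S_{ii}. -/
open Matrix ComplexOrder

section Hadamard

variable {ι 𝕜 : Type*} [Fintype ι] [DecidableEq ι] [RCLike 𝕜]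

/-- A positive definite matrix with unit diagonal, other than the identity, has determinant
less than one. -/
lemma Matrix.PosDef.re_det_lt_one_of_diag_eq_one {C : Matrix ι ι 𝕜} (hC : C.PosDef)
    (hdiag : ∀ i, C i i = 1) (hne : C ≠ 1) : RCLike.re C.det < 1 := by
  have hsum : ∑ i, (hC.1.eigenvalues i - 1) = 0 := by
    have h := hC.1.trace_eq_sum_eigenvalues
    simp only [Matrix.trace, Matrix.diag, hdiag] at h
    rw [Finset.sum_sub_distrib, sub_eq_zero]
    exact_mod_cast h.symm
  obtain ⟨j, hj⟩ : ∃ j, hC.1.eigenvalues j ≠ 1 := by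
    by_contra! h
    apply hne
    rw [hC.1.spectral_theorem]
    have : ((RCLike.ofReal : ℝ → 𝕜) ∘ hC.1.eigenvalues) = 1 := by
      funext i
      simp [h i]
    rw [this, Matrix.diagonal_one', map_one]
  rw [hC.1.det_eq_prod_eigenvalues, ← RCLike.ofReal_prod, RCLike.ofReal_re]
  calc ∏ i, hC.1.eigenvalues i < ∏ i, Real.exp (hC.1.eigenvalues i - 1) := by
        refine Finset.prod_lt_prod (fun i _ => hC.eigenvalues_pos i) (fun i _ => ?_)
          ⟨j, Finset.mem_univ j, ?_⟩
        · linarith [Real.add_one_le_exp (hC.1.eigenvalues i - 1)]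
        · linarith [Real.add_one_lt_exp (sub_ne_zero.mpr hj)]
    _ = 1 := by rw [← Real.exp_sum, hsum, Real.exp_zero]

/-- The strict case of Hadamard's determinant inequality for positive definite matrices. -/
lemma Matrix.PosDef.re_det_lt_prod_diag {S : Matrix ι ι 𝕜} (hS : S.PosDef)
    (hnd : ¬ S.IsDiag) : RCLike.re S.det < ∏ i, RCLike.re (S i i) := by
  have hpos (i : ι) : 0 < RCLike.re (S i i) := (RCLike.pos_iff.mp hS.diag_pos).1
  have hdiag (i : ι) : S i i = (RCLike.re (S i i) : 𝕜) := (hS.1.coe_re_apply_self i).symm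
  set d : ι → ℝ := fun i => (√(RCLike.re (S i i)))⁻¹ with hd
  have hd0 (i : ι) : d i ≠ 0 := (inv_pos.mpr (Real.sqrt_pos.mpr (hpos i))).ne'
  have hdd (i : ι) : d i * d i = (RCLike.re (S i i))⁻¹ := by
    rw [hd, ← mul_inv, Real.mul_self_sqrt (hpos i).le]
  set D : Matrix ι ι 𝕜 := diagonal fun i => (d i : 𝕜) with hD
  have hDH : Dᴴ = D := by
    rw [hD, diagonal_conjTranspose]
    congr 1
    funext i
    simp
  have hDdet : D.det = ((∏ i, d i : ℝ) : 𝕜) := by simp [hD]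
  have hDunit : IsUnit D := by
    rw [Matrix.isUnit_iff_isUnit_det, hDdet, isUnit_iff_ne_zero]
    exact_mod_cast Finset.prod_ne_zero_iff.mpr fun i _ => hd0 i
  have happly (i j : ι) : (D * S * D) i j = d i * S i j * d j := by
    simp [hD, mul_diagonal, diagonal_mul]
  have hC : (D * S * D).PosDef := by
    have h := hS.conjTranspose_mul_mul_same (B := D) (Matrix.mulVec_injective_of_isUnit hDunit)
    rwa [hDH] at h
  have hlt := hC.re_det_lt_one_of_diag_eq_one
    (fun i => by
      rw [happly, hdiag, mul_right_comm]
      exact_mod_cast by rw [hdd, inv_mul_cancel₀ (hpos i).ne'])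
    (fun h => hnd fun i j hij => by
      have hz := happly i j
      rw [h, one_apply_ne hij] at hz
      simpa [hd0] using hz.symm)
  have hdet : (D * S * D).det = (((∏ i, RCLike.re (S i i))⁻¹ : ℝ) : 𝕜) * S.det := by
    rw [det_mul, det_mul, mul_right_comm, hDdet, ← RCLike.ofReal_mul, ← Finset.prod_mul_distrib]
    simp_rw [hdd, Finset.prod_inv_distrib]
  rwa [hdet, RCLike.re_ofReal_mul, inv_mul_lt_one₀ (Finset.prod_pos fun i _ => hpos i)] at hlt

end Hadamard

/-- For any Hermitian positive definite, non-diagonal matrix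
`S ∈ ℂ^{n×n}` (`n ≥ 1`), there exists a unitary `U` such that the product of the
diagonal entries of `U S U*` is strictly smaller than the product of the diagonal
entries of `S` (the diagonal entries being positive reals, we compare real parts). -/
theorem exists_unitary_diagonal_product_lt
    (n : ℕ) (hn : 1 ≤ n) (S : Matrix (Fin n) (Fin n) ℂ)
    (hS : S.PosDef) (hnd : ¬ S.IsDiag) :
    ∃ U : Matrix (Fin n) (Fin n) ℂ, U ∈ Matrix.unitaryGroup (Fin n) ℂ ∧
      ∏ i, ((U * S * Uᴴ) i i).re < ∏ i, (S i i).re := by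
  refine ⟨star hS.1.eigenvectorUnitary, (star hS.1.eigenvectorUnitary).2, ?_⟩
  have hdiag := hS.1.conjStarAlgAut_star_eigenvectorUnitary
  rw [Unitary.conjStarAlgAut_star_apply] at hdiag
  have hlt := hS.re_det_lt_prod_diag hnd
  rw [hS.1.det_eq_prod_eigenvalues, ← RCLike.ofReal_prod, RCLike.ofReal_re] at hlt
  rw [← star_eq_conjTranspose]
  simpa [hdiag] using hlt
end

section
/- Let n ≥ 1, let l ≥ 1 be a natural number, and let S ∈ ℂ^{n×n} be a Hermitian positive definite matrix that is not diagonal. Then there exists a unitary matrix U ∈ ℂ^{n×n} such that Σ_{i=1}^{n} (l/2)·log(2πe·Re((U S U*)_{ii})) < Σ_{i=1}^{n} (l/2)·log(2πe·Re(S_{ii})); that is, the sum of the marginal entropies of the Gaussian processes with covariance matrix U S U* is strictly smaller than the sum of the marginal entropies of those with covariance matrix S. -/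
open Matrix ComplexOrder

namespace Matrix

variable {n : Type*} [Fintype n] [DecidableEq n]

/-- The squared moduli of the entries in a row of a unitary matrix sum to one. -/
theorem sum_normSq_row_of_mem_unitaryGroup {V : Matrix n n ℂ} (hV : V ∈ unitaryGroup n ℂ) (i : n) :
    ∑ j, Complex.normSq (V i j) = 1 := by
  have h := congrFun₂ (mem_unitaryGroup_iff.mp hV) i i
  simp only [star_eq_conjTranspose, mul_apply, conjTranspose_apply, one_apply_eq, Complex.star_def,
    Complex.mul_conj] at h
  exact_mod_cast h

/-- The squared moduli of the entries in a column of a unitary matrix sum to one. -/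
theorem sum_normSq_col_of_mem_unitaryGroup {V : Matrix n n ℂ} (hV : V ∈ unitaryGroup n ℂ) (j : n) :
    ∑ i, Complex.normSq (V i j) = 1 := by
  have h := congrFun₂ (mem_unitaryGroup_iff'.mp hV) j j
  simp only [star_eq_conjTranspose, mul_apply, conjTranspose_apply, one_apply_eq, Complex.star_def,
    ← Complex.normSq_eq_conj_mul_self] at h
  exact_mod_cast h

theorem mul_diagonal_mul_conjTranspose_apply (V : Matrix n n ℂ) (d : n → ℝ) (i k : n) :
    (V * diagonal (fun j => (d j : ℂ)) * Vᴴ) i k = ∑ j, d j * (V i j * star (V k j)) := by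
  rw [mul_apply]
  refine Finset.sum_congr rfl fun j _ => ?_
  rw [mul_diagonal, conjTranspose_apply]
  ring

theorem re_mul_diagonal_mul_conjTranspose_apply_self (V : Matrix n n ℂ) (d : n → ℝ) (i : n) :
    ((V * diagonal (fun j => (d j : ℂ)) * Vᴴ) i i).re = ∑ j, Complex.normSq (V i j) * d j := by
  rw [mul_diagonal_mul_conjTranspose_apply, Complex.re_sum]
  refine Finset.sum_congr rfl fun j _ => ?_
  rw [Complex.star_def, Complex.mul_conj, ← Complex.ofReal_mul, Complex.ofReal_re, mul_comm]

/-- Strict form of Hadamard's determinant inequality, in logarithmic form, for a matrix that is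
given by a unitary diagonalization. -/
theorem sum_log_lt_sum_log_re_diag {V : Matrix n n ℂ} (hV : V ∈ unitaryGroup n ℂ) {d : n → ℝ}
    (hd : ∀ j, 0 < d j) (hnd : ¬ (V * diagonal (fun j => (d j : ℂ)) * Vᴴ).IsDiag) :
    ∑ j, Real.log (d j) <
      ∑ i, Real.log ((V * diagonal (fun j => (d j : ℂ)) * Vᴴ) i i).re := by
  simp only [re_mul_diagonal_mul_conjTranspose_apply_self]
  have hrow := sum_normSq_row_of_mem_unitaryGroup hV
  have hjensen : ∀ i, ∑ j, Complex.normSq (V i j) * Real.log (d j) ≤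
      Real.log (∑ j, Complex.normSq (V i j) * d j) := fun i =>
    strictConcaveOn_log_Ioi.concaveOn.le_map_sum (t := Finset.univ)
      (fun j _ => Complex.normSq_nonneg (V i j)) (hrow i) (fun j _ => hd j)
  have hsum : ∑ j, Real.log (d j) = ∑ i, ∑ j, Complex.normSq (V i j) * Real.log (d j) := by
    rw [Finset.sum_comm]
    simp only [← Finset.sum_mul, sum_normSq_col_of_mem_unitaryGroup hV, one_mul]
  rw [hsum]
  refine (Finset.sum_le_sum fun i _ => hjensen i).lt_of_ne fun heq => hnd fun i k hik => ?_
  have heqi := (Finset.sum_eq_sum_iff_of_le fun i _ => hjensen i).mp heq i (Finset.mem_univ i)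
  have hconst := (strictConcaveOn_log_Ioi.map_sum_eq_iff' (t := Finset.univ)
      (fun j _ => Complex.normSq_nonneg (V i j)) (hrow i) (fun j _ => hd j)).mp heqi.symm
  have horth := congrFun₂ (mem_unitaryGroup_iff.mp hV) i k
  rw [one_apply_ne hik, star_eq_conjTranspose, mul_apply] at horth
  refine (mul_diagonal_mul_conjTranspose_apply V d i k).trans ?_
  set c := ∑ j, Complex.normSq (V i j) • d j
  calc ∑ j, (d j : ℂ) * (V i j * star (V k j)) = ∑ j, (c : ℂ) * (V i j * star (V k j)) := by
        refine Finset.sum_congr rfl fun j _ => ?_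
        by_cases hij : V i j = 0
        · simp [hij]
        · rw [hconst j (Finset.mem_univ j) (by simpa using hij)]
    _ = 0 := by
        rw [← Finset.mul_sum]
        simp only [conjTranspose_apply] at horth
        rw [horth, mul_zero]

end Matrix

/-- For `n ≥ 1`, `l ≥ 1`, and a Hermitian positive definite,
non-diagonal matrix `S ∈ ℂ^{n×n}`, there exists a unitary `U` such that the sum of
the marginal entropies `∑ i, (l/2)·log(2πe·Re((U S U*)_{ii}))` is strictly smaller
than `∑ i, (l/2)·log(2πe·Re(S_{ii}))`. -/
theorem exists_unitary_marginal_entropy_lt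
    (n : ℕ) (hn : 1 ≤ n) (l : ℕ) (hl : 1 ≤ l)
    (S : Matrix (Fin n) (Fin n) ℂ)
    (hS : S.PosDef) (hnd : ¬ S.IsDiag) :
    ∃ U : Matrix (Fin n) (Fin n) ℂ, U ∈ Matrix.unitaryGroup (Fin n) ℂ ∧
      ∑ i, ((l : ℝ) / 2) * Real.log (2 * Real.pi * Real.exp 1 * ((U * S * Uᴴ) i i).re) <
        ∑ i, ((l : ℝ) / 2) * Real.log (2 * Real.pi * Real.exp 1 * (S i i).re) := by
  obtain ⟨V, hV, d, hd, hSV⟩ : ∃ V ∈ unitaryGroup (Fin n) ℂ, ∃ d : Fin n → ℝ,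
      (∀ j, 0 < d j) ∧ S = V * diagonal (fun j => (d j : ℂ)) * Vᴴ :=
    ⟨hS.1.eigenvectorUnitary, hS.1.eigenvectorUnitary.2, hS.1.eigenvalues, hS.eigenvalues_pos,
      hS.1.spectral_theorem⟩
  have hVV : Vᴴ * V = 1 := mem_unitaryGroup_iff'.mp hV
  have hdiag : Vᴴ * S * Vᴴᴴ = diagonal (fun j => (d j : ℂ)) := by
    rw [hSV, conjTranspose_conjTranspose, Matrix.mul_assoc, Matrix.mul_assoc, hVV, Matrix.mul_one,
      ← Matrix.mul_assoc, hVV, Matrix.one_mul]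
  refine ⟨Vᴴ, Unitary.star_mem hV, ?_⟩
  have hlt : ∑ j, Real.log (d j) < ∑ i, Real.log (S i i).re := by
    rw [hSV] at hnd ⊢
    exact sum_log_lt_sum_log_re_diag hV hd hnd
  have hc : 2 * Real.pi * Real.exp 1 ≠ 0 := by positivity
  have hsplit : ∀ x : Fin n → ℝ, (∀ i, 0 < x i) →
      ∑ i, ((l : ℝ) / 2) * Real.log (2 * Real.pi * Real.exp 1 * x i) =
        (l : ℝ) / 2 * (∑ _i : Fin n, Real.log (2 * Real.pi * Real.exp 1) +
          ∑ i, Real.log (x i)) := fun x hx => by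
    rw [← Finset.mul_sum, ← Finset.sum_add_distrib]
    simp only [Real.log_mul hc (hx _).ne']
  simp only [hdiag, diagonal_apply_eq, Complex.ofReal_re]
  rw [hsplit d hd, hsplit _ fun i => (Complex.pos_iff.mp hS.diag_pos).1]
  have hl' : (0 : ℝ) < l := by exact_mod_cast hl
  gcongr
end
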